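/- With notation as in the setup: for every z ∈ W_{S_a}, one has z (w_a w_b) W_J ≤_J (w_a w_b) W_J. In particular S_a ⊆ D^J(w_a w_b). -/

import Mathlib

namespace CoxeterSystem

variable {B : Type*} {W : Type*} [Group W] {M : CoxeterMatrix B}

/-- The standard parabolic subgroup `W_T` of `W`, generated by the simple reflections
indexed by `T ⊆ B`. -/
def parabolic (cs : CoxeterSystem M W) (T : Set B) : Subgroup W :=
  Subgroup.closure (cs.simple '' T)

/-- The Bruhat order on `W`: `u ≤ w` iff some reduced word for `w` contains a subword whose
product is `u`. -/
def bruhatLE (cs : CoxeterSystem M W) (u w : W) : Prop :=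
  ∃ ω : List B, cs.IsReduced ω ∧ cs.wordProd ω = w ∧
    ∃ ω' : List B, ω'.Sublist ω ∧ cs.wordProd ω' = u

/-- `u` is the minimal-length representative `min (w W_T)` of the coset `w W_T`. -/
def IsMinRep (cs : CoxeterSystem M W) (T : Set B) (w u : W) : Prop :=
  w⁻¹ * u ∈ cs.parabolic T ∧
    ∀ v : W, w⁻¹ * v ∈ cs.parabolic T → cs.length u ≤ cs.length v

/-- The Bruhat order on `W / W_T`: `u W_T ≤_T w W_T` iff `min (u W_T) ≤ min (w W_T)` in the
Bruhat order on `W`. -/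
def bruhatLEQuot (cs : CoxeterSystem M W) (T : Set B) (u w : W) : Prop :=
  ∃ u' w' : W, cs.IsMinRep T u u' ∧ cs.IsMinRep T w w' ∧ cs.bruhatLE u' w'

/-- The support of `w`: the set of simple reflections occurring in some reduced word
for `w`. -/
def support (cs : CoxeterSystem M W) (w : W) : Set B :=
  {i | ∃ ω : List B, cs.IsReduced ω ∧ cs.wordProd ω = w ∧ i ∈ ω}

end CoxeterSystem

namespace CoxeterSystem

variable {B : Type*} {W : Type*} [Group W] {M : CoxeterMatrix B}

/-! ### Injectivity of the simple reflections, through the geometric representation -/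

/-- The linear form `v ↦ 2⟨e_i, v⟩` of the geometric representation. -/
noncomputable def geomForm (M : CoxeterMatrix B) (i : B) : Module.Dual ℝ (B →₀ ℝ) :=
  Finsupp.linearCombination ℝ fun j ↦ -2 * Real.cos (Real.pi / M i j)

theorem geomForm_single (i j : B) :
    geomForm M i (Finsupp.single j 1) = -2 * Real.cos (Real.pi / M i j) := by
  simp [geomForm]

theorem geomForm_single_self (i : B) : geomForm M i (Finsupp.single i 1) = 2 := by
  simp [geomForm_single]

/-- The reflection attached to `i` in the geometric representation. -/
noncomputable def geomReflection (M : CoxeterMatrix B) (i : B) : (B →₀ ℝ) ≃ₗ[ℝ] (B →₀ ℝ) :=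
  Module.reflection (geomForm_single_self (M := M) i)

theorem isLiftable_geomReflection : M.IsLiftable (geomReflection M) := by
  intro i j
  rcases eq_or_ne i j with rfl | hij
  · rw [M.diagonal, pow_one]
    ext1 v
    exact Module.involutive_reflection (geomForm_single_self (M := M) i) v
  obtain hm0 | hm2 : M i j = 0 ∨ 2 ≤ M i j := by
    have := M.off_diagonal i j hij
    lia
  · rw [hm0, pow_zero]
  have hij' : geomForm M i (Finsupp.single j 1) = -2 * Real.cos (Real.pi / M i j) :=
    geomForm_single i j
  have hji' : geomForm M j (Finsupp.single i 1) = -2 * Real.cos (Real.pi / M i j) := by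
    rw [geomForm_single, M.symmetric]
  generalize M i j = m at *
  have hm0 : (m : ℝ) ≠ 0 := by positivity
  ext1 z
  rw [geomReflection, geomReflection, Module.reflection_mul_reflection_pow_apply _ _ m z
    (2 * Real.cos (2 * (Real.pi / m)))
    (by rw [hij', hji', Real.cos_two_mul]; ring), hij', hji']
  rcases eq_or_ne m 2 with rfl | hm
  · rw [show 2 * (Real.pi / (2 : ℕ)) = Real.pi by push_cast; ring]
    norm_num
    module
  have hm3 : (3 : ℝ) ≤ m := by exact_mod_cast (show 3 ≤ m by lia)
  set θ := 2 * (Real.pi / m) with hθ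
  have hmθ : m * θ = 2 * Real.pi := by rw [hθ]; field_simp
  have hsin : Real.sin θ ≠ 0 := by
    have h0 : 0 < θ := by positivity
    have h1 : θ < Real.pi := by nlinarith [Real.pi_pos]
    exact (Real.sin_pos_of_pos_of_lt_pi h0 h1).ne'
  have hS (n : ℤ) := Polynomial.Chebyshev.S_two_mul_real_cos θ n
  obtain ⟨k, rfl | rfl⟩ := m.even_or_odd'
  · have h1 : (((2 * k : ℕ) : ℤ) - 2) / 2 = k - 1 := by lia
    have h2 : (((2 * k : ℕ) : ℤ) - 1) / 2 = k - 1 := by lia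
    have h0 : (Polynomial.Chebyshev.S ℝ (k - 1)).eval (2 * Real.cos θ) = 0 := by
      have := hS (k - 1)
      rw [show ((((k : ℤ) - 1 : ℤ) : ℝ) + 1) * θ = Real.pi by
        push_cast at hmθ ⊢; linarith, Real.sin_pi] at this
      exact (mul_eq_zero.mp this).resolve_right hsin
    rw [h1, h2, h0]
    simp
  · have h1 : (((2 * k + 1 : ℕ) : ℤ) - 2) / 2 = k - 1 := by lia
    have h2 : (((2 * k + 1 : ℕ) : ℤ) - 1) / 2 = k := by lia
    have h3 : (((2 * k + 1 : ℕ) : ℤ) - 3) / 2 = k - 1 := by lia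
    have h4 : ((2 * k + 1 : ℕ) : ℤ) / 2 = k := by lia
    have h0 : (Polynomial.Chebyshev.S ℝ k).eval (2 * Real.cos θ) +
        (Polynomial.Chebyshev.S ℝ (k - 1)).eval (2 * Real.cos θ) = 0 := by
      have e1 := hS k
      have e2 := hS (k - 1)
      rw [show (((k : ℤ) : ℝ) + 1) * θ = 2 * Real.pi - k * θ by
        push_cast at hmθ ⊢; linarith, Real.sin_two_pi_sub] at e1
      rw [show ((((k : ℤ) - 1 : ℤ) : ℝ) + 1) * θ = k * θ by push_cast; ring] at e2
      exact (mul_eq_zero.mp (by linear_combination e1 + e2)).resolve_right hsin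
    rw [h1, h2, h3, h4, h0]
    simp

theorem simple_injective (cs : CoxeterSystem M W) : Function.Injective cs.simple := by
  intro i j hij
  by_contra hne
  have h := congrArg (cs.lift ⟨_, isLiftable_geomReflection⟩) hij
  rw [lift_apply_simple, lift_apply_simple] at h
  have h' := DFunLike.congr_fun (LinearEquiv.congr_fun h (Finsupp.single i 1)) i
  rw [geomReflection, geomReflection, Module.reflection_apply, Module.reflection_apply,
    geomForm_single_self] at h'
  simp [Ne.symm hne] at h'

/-! ### The strong exchange property -/

section Exchange

open Classical in
/-- The permutation `(t, ε) ↦ (s_i t s_i, ε + [t = s_i])` of `W × ZMod 2`. -/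
noncomputable def signedConj (cs : CoxeterSystem M W) (i : B) : Equiv.Perm (W × ZMod 2) :=
  Function.Involutive.toPerm
    (fun p ↦ (cs.simple i * p.1 * cs.simple i, p.2 + if p.1 = cs.simple i then 1 else 0)) <| by
    rintro ⟨t, ε⟩
    have h : cs.simple i * t * cs.simple i = cs.simple i ↔ t = cs.simple i := by
      rw [mul_assoc, mul_eq_left, ← inv_simple, mul_inv_eq_one]
      simp
    by_cases ht : t = cs.simple i
    · simp [ht, add_assoc, CharTwo.add_self_eq_zero]
    · simp only [h, ht]
      simp [mul_assoc]

open Classical in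
theorem signedConj_apply (cs : CoxeterSystem M W) (i : B) (t : W) (ε : ZMod 2) :
    cs.signedConj i (t, ε) =
      (cs.simple i * t * cs.simple i, ε + if t = cs.simple i then 1 else 0) := rfl

open Classical in
theorem prod_reverse_signedConj_apply (cs : CoxeterSystem M W) (ω : List B) (t : W)
    (ε : ZMod 2) :
    (ω.reverse.map cs.signedConj).prod (t, ε) =
      ((cs.wordProd ω)⁻¹ * t * cs.wordProd ω, ε + ((cs.leftInvSeq ω).count t : ZMod 2)) := by
  induction ω generalizing t ε with
  | nil => simp
  | cons i ω ih =>
    have hcount : ((cs.leftInvSeq ω).map (MulAut.conj (cs.simple i))).count t =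
        (cs.leftInvSeq ω).count (cs.simple i * t * cs.simple i) := by
      have : t = MulAut.conj (cs.simple i) (cs.simple i * t * cs.simple i) := by
        simp [mul_assoc]
      conv_lhs => rw [this]
      exact List.count_map_of_injective _ _ (MulAut.conj (cs.simple i)).injective _
    rw [List.reverse_cons, List.map_append, List.prod_append, Equiv.Perm.mul_apply]
    simp only [List.map_cons, List.map_nil, List.prod_singleton, signedConj_apply, ih]
    rw [leftInvSeq, List.count_cons, hcount, wordProd_cons]
    ext
    · simp [mul_assoc]
    · simp only [beq_iff_eq, eq_comm (a := cs.simple i)]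
      push_cast
      ring

theorem prod_map_reverse_alternatingWord {G : Type*} [Monoid G] (f : B → G) (i j : B) (p : ℕ) :
    ((alternatingWord i j (2 * p)).reverse.map f).prod = (f j * f i) ^ p := by
  induction p with
  | zero => simp [alternatingWord]
  | succ p ih =>
    rw [show 2 * (p + 1) = 2 * p + 1 + 1 by ring, alternatingWord_succ', alternatingWord_succ']
    simp only [List.map_reverse] at ih
    simp [ih, pow_succ]

theorem isLiftable_signedConj (cs : CoxeterSystem M W) : M.IsLiftable cs.signedConj := by
  classical
  intro j i
  rw [← prod_map_reverse_alternatingWord, M.symmetric]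
  ext1 ⟨t, ε⟩
  rw [prod_reverse_signedConj_apply]
  have hprod : cs.wordProd (alternatingWord i j (2 * M i j)) = 1 := by
    rw [prod_alternatingWord_eq_mul_pow]
    simp
  set L := cs.leftInvSeq (alternatingWord i j (2 * M i j)) with hL
  have hlen : L.length = 2 * M i j := by simp [hL]
  have hperiod : L.drop (M i j) = L.take (M i j) := by
    apply List.ext_getElem
    · simp [hlen]; lia
    intro k h1 h2
    rw [List.getElem_drop, List.getElem_take]
    simp only [List.length_take, hlen] at h2
    rw [getElem_leftInvSeq_alternatingWord cs i j _ _ (by lia),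
      getElem_leftInvSeq_alternatingWord cs i j _ _ (by lia),
      prod_alternatingWord_eq_mul_pow, prod_alternatingWord_eq_mul_pow]
    have e1 : (2 * (M i j + k) + 1) / 2 = M i j + k := by lia
    have e2 : (2 * k + 1) / 2 = k := by lia
    simp [e1, e2, pow_add]
  have hcount : (L.count t : ZMod 2) = 0 := by
    rw [← List.take_append_drop (M i j) L, hperiod, List.count_append]
    push_cast
    exact CharTwo.add_self_eq_zero _
  simp [hprod, hcount]

/-- The action of `W` on `W × ZMod 2` extending `signedConj`. -/
noncomputable def signedAction (cs : CoxeterSystem M W) : W →* Equiv.Perm (W × ZMod 2) :=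
  cs.lift ⟨cs.signedConj, cs.isLiftable_signedConj⟩

open Classical in
theorem signedAction_inv_wordProd (cs : CoxeterSystem M W) (ω : List B) (t : W) (ε : ZMod 2) :
    cs.signedAction (cs.wordProd ω)⁻¹ (t, ε) =
      ((cs.wordProd ω)⁻¹ * t * cs.wordProd ω, ε + ((cs.leftInvSeq ω).count t : ZMod 2)) := by
  rw [← prod_reverse_signedConj_apply, ← wordProd_reverse, wordProd, map_list_prod, List.map_map]
  congr 3
  ext1 i
  exact lift_apply_simple cs cs.isLiftable_signedConj i

theorem signedAction_inv_apply_eq_add (cs : CoxeterSystem M W) (w t : W) (ε : ZMod 2) :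
    cs.signedAction w⁻¹ (t, ε) = (w⁻¹ * t * w, ε + (cs.signedAction w⁻¹ (t, 0)).2) := by
  obtain ⟨ω, rfl⟩ := cs.wordProd_surjective w
  simp only [signedAction_inv_wordProd, zero_add]

theorem IsReflection.signedAction_apply_self {cs : CoxeterSystem M W} {t : W}
    (ht : cs.IsReflection t) (ε : ZMod 2) : cs.signedAction t⁻¹ (t, ε) = (t, ε + 1) := by
  obtain ⟨u, i, rfl⟩ := ht
  set t := u * cs.simple i * u⁻¹ with htdef
  set c := (cs.signedAction u⁻¹ (t, 0)).2 with hc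
  have hconj : u⁻¹ * t * u = cs.simple i := by simp [htdef, mul_assoc]
  have h1 (δ : ZMod 2) : cs.signedAction u⁻¹ (t, δ) = (cs.simple i, δ + c) := by
    rw [signedAction_inv_apply_eq_add, hconj]
  have h2 (δ : ZMod 2) : cs.signedAction (cs.simple i) (cs.simple i, δ) =
      (cs.simple i, δ + 1) := by
    rw [signedAction, lift_apply_simple, signedConj_apply]
    simp
  have h3 : cs.signedAction u (cs.simple i, ε + c + 1) = (t, ε + 1) := by
    have := h1 (ε + 1)
    rw [map_inv, Equiv.Perm.inv_def, Equiv.symm_apply_eq] at this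
    rw [this]
    congr 2
    ring
  rw [show t⁻¹ = u * cs.simple i * u⁻¹ by simp [htdef, mul_assoc], map_mul, map_mul,
    Equiv.Perm.mul_apply, Equiv.Perm.mul_apply, h1, h2, h3]

/-- The strong exchange property. -/
theorem IsLeftInversion.exists_eraseIdx {cs : CoxeterSystem M W} {ω : List B} {t : W}
    (ht : cs.IsLeftInversion (cs.wordProd ω) t) :
    ∃ k < ω.length, t * cs.wordProd ω = cs.wordProd (ω.eraseIdx k) := by
  classical
  have key (ω : List B) (h : (cs.signedAction (cs.wordProd ω)⁻¹ (t, 0)).2 ≠ 0) :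
      t ∈ cs.leftInvSeq ω := by
    rw [signedAction_inv_wordProd] at h
    by_contra hmem
    simp [List.count_eq_zero_of_not_mem hmem] at h
  obtain ⟨ht1, ht2⟩ := ht
  have hmem : t ∈ cs.leftInvSeq ω := by
    apply key
    intro h0
    obtain ⟨ω', hω', hw'⟩ := cs.exists_isReduced (t * cs.wordProd ω)
    have hmem' : t ∈ cs.leftInvSeq ω' := by
      apply key
      rw [← hw', mul_inv_rev, map_mul, Equiv.Perm.mul_apply, ht1.signedAction_apply_self,
        signedAction_inv_apply_eq_add, h0]
      simp
    have := (cs.isLeftInversion_of_mem_leftInvSeq hω' hmem').2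
    rw [← hw', ← mul_assoc, ht1.mul_self, one_mul] at this
    lia
  obtain ⟨k, hk, hkt⟩ := List.getElem_of_mem hmem
  refine ⟨k, by simpa using hk, ?_⟩
  rw [← getD_leftInvSeq_mul_wordProd, List.getD_eq_getElem _ _ hk, hkt]

end Exchange

end CoxeterSystem

namespace CoxeterSystem

variable {B : Type*} {W : Type*} [Group W] {M : CoxeterMatrix B} {cs : CoxeterSystem M W}

/-! ### Reduced words in parabolic subgroups -/

/-- The deletion property: every word contains a reduced subword with the same product. -/
theorem exists_isReduced_sublist (cs : CoxeterSystem M W) (ω : List B) :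
    ∃ ω' : List B, ω'.Sublist ω ∧ cs.IsReduced ω' ∧ cs.wordProd ω' = cs.wordProd ω := by
  induction ω with
  | nil => exact ⟨[], .refl _, by simp [IsReduced], rfl⟩
  | cons i ω ih =>
    obtain ⟨ω', hsub, hred, hprod⟩ := ih
    rcases cs.length_simple_mul (cs.wordProd ω') i with h | h
    · refine ⟨i :: ω', hsub.cons_cons i, ?_, by rw [wordProd_cons, wordProd_cons, hprod]⟩
      rw [IsReduced, wordProd_cons, h, hred.eq, List.length_cons]
    · obtain ⟨k, hk, hkω⟩ := IsLeftInversion.exists_eraseIdx (cs := cs) (ω := ω')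
        (t := cs.simple i) ⟨cs.isReflection_simple i, by lia⟩
      refine ⟨ω'.eraseIdx k, ((List.eraseIdx_sublist ω' k).trans hsub).cons i, ?_, ?_⟩
      · rw [hred.eq] at h
        rw [IsReduced, ← hkω, List.length_eraseIdx_of_lt hk]
        lia
      · rw [← hkω, wordProd_cons, hprod]

theorem wordProd_mem_parabolic (cs : CoxeterSystem M W) {T : Set B} {ω : List B}
    (h : ∀ i ∈ ω, i ∈ T) : cs.wordProd ω ∈ cs.parabolic T := by
  refine Subgroup.list_prod_mem _ fun x hx ↦ ?_
  obtain ⟨i, hi, rfl⟩ := List.mem_map.mp hx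
  exact Subgroup.subset_closure ⟨i, h i hi, rfl⟩

theorem simple_mem_parabolic (cs : CoxeterSystem M W) {T : Set B} {i : B} (h : i ∈ T) :
    cs.simple i ∈ cs.parabolic T :=
  Subgroup.subset_closure ⟨i, h, rfl⟩

theorem parabolic_mono (cs : CoxeterSystem M W) {T T' : Set B} (h : T ⊆ T') :
    cs.parabolic T ≤ cs.parabolic T' :=
  Subgroup.closure_mono (Set.image_mono h)

theorem exists_wordProd_of_mem_parabolic {T : Set B} {x : W} (hx : x ∈ cs.parabolic T) :
    ∃ ω : List B, (∀ i ∈ ω, i ∈ T) ∧ cs.wordProd ω = x := by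
  induction hx using Subgroup.closure_induction with
  | mem x hx =>
    obtain ⟨i, hi, rfl⟩ := hx
    exact ⟨[i], by simpa using hi, by simp⟩
  | one => exact ⟨[], by simp, by simp⟩
  | mul x y _ _ hx hy =>
    obtain ⟨ω, hω, rfl⟩ := hx
    obtain ⟨ω', hω', rfl⟩ := hy
    refine ⟨ω ++ ω', fun i hi ↦ ?_, cs.wordProd_append ω ω'⟩
    exact (List.mem_append.mp hi).elim (hω i) (hω' i)
  | inv x _ hx =>
    obtain ⟨ω, hω, rfl⟩ := hx
    exact ⟨ω.reverse, by simpa using hω, cs.wordProd_reverse ω⟩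

theorem exists_isReduced_of_mem_parabolic {T : Set B} {x : W} (hx : x ∈ cs.parabolic T) :
    ∃ ω : List B, (∀ i ∈ ω, i ∈ T) ∧ cs.IsReduced ω ∧ cs.wordProd ω = x := by
  obtain ⟨ω, hω, rfl⟩ := exists_wordProd_of_mem_parabolic hx
  obtain ⟨ω', hsub, hred, hprod⟩ := cs.exists_isReduced_sublist ω
  exact ⟨ω', fun i hi ↦ hω i (hsub.subset hi), hred, hprod⟩

theorem mem_of_simple_mem_parabolic {T : Set B} {i : B}
    (h : cs.simple i ∈ cs.parabolic T) : i ∈ T := by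
  obtain ⟨ω, hω, hred, hprod⟩ := exists_isReduced_of_mem_parabolic h
  have hlen := hred.eq
  rw [hprod, length_simple] at hlen
  obtain ⟨k, rfl⟩ := List.length_eq_one_iff.mp hlen.symm
  rw [wordProd_singleton] at hprod
  rw [← cs.simple_injective hprod]
  exact hω k (by simp)

/-- All letters of a reduced word of an element of `W_T` lie in `T`. -/
theorem IsReduced.mem_of_wordProd_mem_parabolic {T : Set B} {ω : List B}
    (hω : cs.IsReduced ω) (h : cs.wordProd ω ∈ cs.parabolic T) : ∀ i ∈ ω, i ∈ T := by
  induction ω with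
  | nil => simp
  | cons i ω ih =>
    have hω' : cs.IsReduced ω := by simpa using hω.drop 1
    obtain ⟨κ, hκ, hκprod⟩ := exists_wordProd_of_mem_parabolic h
    have hinv : cs.IsLeftInversion (cs.wordProd κ) (cs.simple i) := by
      refine ⟨cs.isReflection_simple i, ?_⟩
      rw [hκprod, hω.eq, wordProd_cons, simple_mul_simple_cancel_left, hω'.eq]
      simp
    obtain ⟨k, -, hk⟩ := hinv.exists_eraseIdx
    have htail : cs.wordProd ω ∈ cs.parabolic T := by
      rw [hκprod, wordProd_cons, simple_mul_simple_cancel_left] at hk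
      rw [hk]
      exact cs.wordProd_mem_parabolic fun j hj ↦ hκ j (List.mem_of_mem_eraseIdx hj)
    have hi : i ∈ T := by
      rw [wordProd_cons, Subgroup.mul_mem_cancel_right _ htail] at h
      exact mem_of_simple_mem_parabolic h
    intro j hj
    rcases List.mem_cons.mp hj with rfl | hj
    · exact hi
    · exact ih hω' htail j hj

/-! ### Minimal coset representatives -/

theorem IsMinRep.self {T : Set B} {w u : W} (h : cs.IsMinRep T w u) : cs.IsMinRep T u u := by
  refine ⟨by simp, fun v hv ↦ h.2 v ?_⟩
  simpa [mul_assoc] using mul_mem h.1 hv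

theorem IsMinRep.of_mem {T : Set B} {w u : W} (h : cs.IsMinRep T u u)
    (hwu : w⁻¹ * u ∈ cs.parabolic T) : cs.IsMinRep T w u := by
  refine ⟨hwu, fun v hv ↦ h.2 v ?_⟩
  simpa [mul_assoc] using mul_mem (inv_mem hwu) hv

theorem exists_isMinRep (cs : CoxeterSystem M W) (T : Set B) (w : W) :
    ∃ u, cs.IsMinRep T w u := by
  obtain ⟨u, hu, hmin⟩ := WellFounded.has_min (measure cs.length).wf
    {v | w⁻¹ * v ∈ cs.parabolic T} ⟨w, by simp⟩
  exact ⟨u, hu, fun v hv ↦ not_lt.mp (hmin v hv)⟩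

theorem IsMinRep.mem_parabolic {J K : Set B} (hJK : J ⊆ K) {w u : W}
    (h : cs.IsMinRep J w u) (hw : w ∈ cs.parabolic K) : u ∈ cs.parabolic K := by
  simpa using mul_mem hw (cs.parabolic_mono hJK h.1)

theorem IsMinRep.length_mul {T : Set B} {u v : W} (hu : cs.IsMinRep T u u)
    (hv : v ∈ cs.parabolic T) : cs.length (u * v) = cs.length u + cs.length v := by
  refine le_antisymm (cs.length_mul_le u v) ?_
  obtain ⟨ω, hω, rfl⟩ := cs.exists_isReduced u
  obtain ⟨κ, hκT, hκ, rfl⟩ := exists_isReduced_of_mem_parabolic hv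
  obtain ⟨ρ, hsub, hρ, hprod⟩ := cs.exists_isReduced_sublist (ω ++ κ)
  obtain ⟨ω', κ', rfl, hω', hκ'⟩ := List.sublist_append_iff.mp hsub
  rw [wordProd_append, wordProd_append] at hprod
  have hκ'T : cs.wordProd κ' ∈ cs.parabolic T :=
    cs.wordProd_mem_parabolic fun i hi ↦ hκT i (hκ'.subset hi)
  have hle : cs.length (cs.wordProd ω) ≤ cs.length (cs.wordProd ω') := by
    apply hu.2
    rw [show (cs.wordProd ω)⁻¹ * cs.wordProd ω' = cs.wordProd κ * (cs.wordProd κ')⁻¹ by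
      rw [inv_mul_eq_iff_eq_mul, ← mul_assoc, ← hprod, mul_inv_cancel_right]]
    exact mul_mem hv (inv_mem hκ'T)
  have hωω' : ω' = ω :=
    hω'.eq_of_length_le (by rw [← hω.eq]; exact hle.trans (cs.length_wordProd_le ω'))
  subst hωω'
  have hκκ' : κ.length ≤ κ'.length := by
    rw [← hκ.eq, ← mul_left_cancel hprod]
    exact cs.length_wordProd_le κ'
  rw [← hprod, ← wordProd_append, hρ.eq, hω.eq, hκ.eq, List.length_append]
  lia

theorem IsMinRep.mul {J L : Set B} (hJL : J ⊆ L) {u y : W} (hu : cs.IsMinRep L u u)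
    (hy : cs.IsMinRep J y y) (hyL : y ∈ cs.parabolic L) :
    cs.IsMinRep J (u * y) (u * y) := by
  refine ⟨by simp, fun v hv ↦ ?_⟩
  have hv' : v = u * (y * ((u * y)⁻¹ * v)) := by group
  have hvL := cs.parabolic_mono hJL hv
  rw [hv', hu.length_mul hyL, hu.length_mul (mul_mem hyL hvL), hy.length_mul hv]
  lia

/-- An element of `W_K` that is minimal modulo `W_{K ∩ L}` is minimal modulo `W_L`. -/
theorem IsMinRep.of_inter {K L : Set B} {u : W} (huK : u ∈ cs.parabolic K)
    (hu : cs.IsMinRep (K ∩ L) u u) : cs.IsMinRep L u u := by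
  obtain ⟨m, hm⟩ := cs.exists_isMinRep L u
  refine ⟨by simp, fun v hv ↦ le_trans (hu.2 m ?_) (hm.2 v hv)⟩
  set x := m⁻¹ * u with hx
  have hxL : x ∈ cs.parabolic L := by simpa [hx] using inv_mem hm.1
  obtain ⟨ω, hω, hωm⟩ := cs.exists_isReduced m
  obtain ⟨κ, hκL, hκ, hκx⟩ := exists_isReduced_of_mem_parabolic hxL
  have hprod : cs.wordProd (ω ++ κ) = u := by
    rw [wordProd_append, ← hωm, hκx, hx, mul_inv_cancel_left]
  have hred : cs.IsReduced (ω ++ κ) := by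
    rw [IsReduced, wordProd_append, ← hωm, hκx, hm.self.length_mul hxL, hωm, ← hκx, hω.eq,
      hκ.eq, List.length_append]
  have hK := hred.mem_of_wordProd_mem_parabolic (hprod.symm ▸ huK)
  have hxKL : x ∈ cs.parabolic (K ∩ L) := by
    rw [← hκx]
    exact cs.wordProd_mem_parabolic fun i hi ↦ ⟨hK i (List.mem_append_right _ hi), hκL i hi⟩
  rw [show u⁻¹ * m = x⁻¹ by simp [hx]]
  exact inv_mem hxKL

/-! ### Longest elements of finite parabolic subgroups -/

theorem exists_longest {T : Set B} (hfin : (cs.parabolic T : Set W).Finite) :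
    ∃ w ∈ cs.parabolic T, ∀ v ∈ cs.parabolic T, cs.length v ≤ cs.length w :=
  Set.exists_max_image _ cs.length hfin ⟨1, one_mem _⟩

theorem length_add_length_inv_mul_of_longest {T : Set B} {w x : W} (hw : w ∈ cs.parabolic T)
    (hmax : ∀ v ∈ cs.parabolic T, cs.length v ≤ cs.length w) (hx : x ∈ cs.parabolic T) :
    cs.length x + cs.length (x⁻¹ * w) = cs.length w := by
  obtain ⟨ω, hωT, hω, rfl⟩ := exists_isReduced_of_mem_parabolic hx
  clear hx
  induction ω using List.reverseRecOn with
  | nil => simp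
  | append_singleton ω i ih =>
    have hω' : cs.IsReduced ω := by simpa using hω.take ω.length
    have ih := ih (fun j hj ↦ hωT j (List.mem_append_left _ hj)) hω'
    have hi : cs.simple i ∈ cs.parabolic T := cs.simple_mem_parabolic (hωT i (by simp))
    have hx : cs.wordProd ω ∈ cs.parabolic T :=
      cs.wordProd_mem_parabolic fun j hj ↦ hωT j (List.mem_append_left _ hj)
    set x := cs.wordProd ω with hxω
    obtain ⟨κ, hκ, hκy⟩ := cs.exists_isReduced (x⁻¹ * w)
    have hwκ : cs.wordProd (ω ++ κ) = w := by
      rw [wordProd_append, ← hκy, ← hxω, mul_inv_cancel_left]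
    have ht : cs.IsReflection (x * cs.simple i * x⁻¹) := ⟨x, i, rfl⟩
    have hinv : cs.IsLeftInversion (cs.wordProd (ω ++ κ)) (x * cs.simple i * x⁻¹) := by
      rw [hwκ]
      exact ⟨ht, lt_of_le_of_ne (hmax _ (mul_mem (mul_mem (mul_mem hx hi) (inv_mem hx)) hw))
        (ht.length_mul_right_ne w)⟩
    have hxi : cs.length (x * cs.simple i) = cs.length x + 1 := by
      have := hω.eq
      rw [wordProd_append, wordProd_singleton] at this
      rw [this, hω'.eq, List.length_append, List.length_singleton]
    obtain ⟨k, hk, hkω⟩ := hinv.exists_eraseIdx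
    have htw : x * cs.simple i * x⁻¹ * cs.wordProd (ω ++ κ) =
        x * cs.simple i * cs.wordProd κ := by
      rw [wordProd_append]
      simp [← hxω, mul_assoc]
    rw [htw] at hkω
    rw [wordProd_append, wordProd_singleton, ← hxω, hxi,
      show (x * cs.simple i)⁻¹ * w = cs.simple i * cs.wordProd κ by
        rw [← hκy]; simp [mul_assoc]]
    rw [hκy] at ih
    rcases lt_or_ge k ω.length with hkl | hkl
    · rw [List.eraseIdx_append_of_lt_length hkl, wordProd_append] at hkω
      have h1 := cs.length_wordProd_le (ω.eraseIdx k)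
      rw [← mul_right_cancel hkω, hxi, hω'.eq, List.length_eraseIdx_of_lt hkl] at h1
      lia
    · rw [List.eraseIdx_append_of_length_le hkl, wordProd_append, ← hxω, mul_assoc] at hkω
      have hkκ : k - ω.length < κ.length := by
        rw [List.length_append] at hk
        lia
      have h1 := cs.length_wordProd_le (κ.eraseIdx (k - ω.length))
      rw [← mul_left_cancel hkω, List.length_eraseIdx_of_lt hkκ, ← hκ.eq] at h1
      rcases cs.length_simple_mul (cs.wordProd κ) i with h2 | h2 <;> lia

theorem length_mul_inv_add_length_of_longest {T : Set B} {w x : W} (hw : w ∈ cs.parabolic T)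
    (hmax : ∀ v ∈ cs.parabolic T, cs.length v ≤ cs.length w) (hx : x ∈ cs.parabolic T) :
    cs.length (w * x⁻¹) + cs.length x = cs.length w := by
  have h := length_add_length_inv_mul_of_longest (w := w⁻¹) (inv_mem hw)
    (by simpa using hmax) (inv_mem hx)
  rw [length_inv, length_inv, ← cs.length_inv (x⁻¹⁻¹ * w⁻¹)] at h
  rw [← h, add_comm]
  simp

/-- The longest minimal representative of `W_K / W_J` has every minimal representative as a
reduced suffix. -/
theorem IsMinRep.length_mul_inv_add_length {J K : Set B} (hJK : J ⊆ K)
    (hfin : (cs.parabolic K : Set W).Finite) {w : W} (hwK : w ∈ cs.parabolic K)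
    (hw : cs.IsMinRep J w w)
    (hmax : ∀ v ∈ cs.parabolic K, cs.IsMinRep J v v → cs.length v ≤ cs.length w)
    {u : W} (huK : u ∈ cs.parabolic K) (hu : cs.IsMinRep J u u) :
    cs.length (w * u⁻¹) + cs.length u = cs.length w := by
  obtain ⟨w₀, hw₀, hw₀max⟩ := exists_longest hfin
  obtain ⟨v₀, hv₀, hv₀max⟩ := exists_longest (hfin.subset (cs.parabolic_mono hJK))
  have hv₀K := cs.parabolic_mono hJK hv₀
  have hsub {v : W} (hv : v ∈ cs.parabolic K) :=
    length_mul_inv_add_length_of_longest hw₀ hw₀max hv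
  set w' := w₀ * v₀⁻¹ with hw'
  have hw'K : w' ∈ cs.parabolic K := mul_mem hw₀ (inv_mem hv₀K)
  have hw'min : cs.IsMinRep J w' w' := by
    refine ⟨by simp, fun v hv ↦ ?_⟩
    have hx : v⁻¹ * w₀ ∈ cs.parabolic J := by
      rw [show v⁻¹ * w₀ = (w'⁻¹ * v)⁻¹ * v₀ by simp [hw', mul_assoc]]
      exact mul_mem (inv_mem hv) hv₀
    have h1 := hsub (cs.parabolic_mono hJK hx)
    have h2 := hsub hv₀K
    have h3 := hv₀max _ hx
    rw [show w₀ * (v⁻¹ * w₀)⁻¹ = v by group] at h1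
    lia
  have key {u : W} (huK : u ∈ cs.parabolic K) (hu : cs.IsMinRep J u u) :
      cs.length (w' * u⁻¹) + cs.length u = cs.length w' := by
    have h1 := hsub (mul_mem huK hv₀K)
    have h2 := hsub hv₀K
    rw [hu.length_mul hv₀, mul_inv_rev, ← mul_assoc, ← hw'] at h1
    lia
  have hww' : w' = w := by
    have h1 := key hwK hw
    have h2 := hmax _ hw'K hw'min
    exact mul_inv_eq_one.mp (cs.length_eq_zero_iff.mp (by lia))
  rw [← hww']
  exact key huK hu

theorem bruhatLE_mul_mul {w w' u u' : W}
    (hu : cs.length (w * u⁻¹) + cs.length u = cs.length w)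
    (hu' : cs.length (w' * u'⁻¹) + cs.length u' = cs.length w')
    (hww' : cs.length (w * w') = cs.length w + cs.length w') :
    cs.bruhatLE (u * u') (w * w') := by
  obtain ⟨α, hα, hαu⟩ := cs.exists_isReduced (w * u⁻¹)
  obtain ⟨β, hβ, hβu⟩ := cs.exists_isReduced u
  obtain ⟨γ, hγ, hγu⟩ := cs.exists_isReduced (w' * u'⁻¹)
  obtain ⟨δ, hδ, hδu⟩ := cs.exists_isReduced u'
  have hprod : cs.wordProd (α ++ β ++ (γ ++ δ)) = w * w' := by
    simp only [wordProd_append, ← hαu, ← hβu, ← hγu, ← hδu, inv_mul_cancel_right]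
  refine ⟨α ++ β ++ (γ ++ δ), ?_, hprod, β ++ δ, ?_, ?_⟩
  · rw [IsReduced, hprod, hww', ← hu, ← hu', hαu, hγu, hα.eq, hγ.eq, hβu, hδu, hβ.eq, hδ.eq]
    simp only [List.length_append]
  · exact (List.sublist_append_right α β).append (List.sublist_append_right γ δ)
  · rw [wordProd_append, ← hβu, ← hδu]

end CoxeterSystem

/-- With `a ≠ b` in `B`, `J = S \ {a, b}`, and `w_a`, `w_b` the maximal-length elements of
`W_{S_a}^J` and `W_{S_b}^J` (assumed finite parabolics): for every `z ∈ W_{S_a}` one has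
`z (w_a w_b) W_J ≤_J (w_a w_b) W_J`.  In particular `S_a ⊆ D^J(w_a w_b)`. -/
theorem parabolic_subgroup_le_descents
    {B : Type*} {W : Type*} [Group W] {M : CoxeterMatrix B} (cs : CoxeterSystem M W)
    (a b : B) (hab : a ≠ b)
    (hfina : (↑(cs.parabolic {a}ᶜ) : Set W).Finite)
    (hfinb : (↑(cs.parabolic {b}ᶜ) : Set W).Finite)
    (wa : W) (hwa_mem : wa ∈ cs.parabolic {a}ᶜ)
    (hwa_min : cs.IsMinRep ({a, b}ᶜ) wa wa)
    (hwa_max : ∀ v ∈ cs.parabolic {a}ᶜ, cs.IsMinRep ({a, b}ᶜ) v v →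
      cs.length v ≤ cs.length wa)
    (wb : W) (hwb_mem : wb ∈ cs.parabolic {b}ᶜ)
    (hwb_min : cs.IsMinRep ({a, b}ᶜ) wb wb)
    (hwb_max : ∀ v ∈ cs.parabolic {b}ᶜ, cs.IsMinRep ({a, b}ᶜ) v v →
      cs.length v ≤ cs.length wb) :
    (∀ z ∈ cs.parabolic {a}ᶜ,
      cs.bruhatLEQuot ({a, b}ᶜ) (z * (wa * wb)) (wa * wb)) ∧
    (∀ s : B, s ≠ a →
      cs.bruhatLEQuot ({a, b}ᶜ) (cs.simple s * (wa * wb)) (wa * wb)) := by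
  have hJa : ({a, b}ᶜ : Set B) ⊆ {a}ᶜ := Set.compl_subset_compl.mpr (by simp)
  have hJb : ({a, b}ᶜ : Set B) ⊆ {b}ᶜ := Set.compl_subset_compl.mpr (by simp)
  have hJ : ({a, b}ᶜ : Set B) = {a}ᶜ ∩ {b}ᶜ := by rw [Set.insert_eq, Set.compl_union]
  have hmin {u : W} (hu : u ∈ cs.parabolic {a}ᶜ) (h : cs.IsMinRep ({a, b}ᶜ) u u) :
      cs.IsMinRep {b}ᶜ u u := .of_inter hu (hJ ▸ h)
  have main : ∀ z ∈ cs.parabolic {a}ᶜ,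
      cs.bruhatLEQuot ({a, b}ᶜ) (z * (wa * wb)) (wa * wb) := by
    intro z hz
    obtain ⟨u, hu⟩ := cs.exists_isMinRep ({a, b}ᶜ) (z * wa)
    have hua := hu.mem_parabolic hJa (mul_mem hz hwa_mem)
    obtain ⟨y, hy⟩ := cs.exists_isMinRep ({a, b}ᶜ) (u⁻¹ * (z * wa) * wb)
    have hux : u⁻¹ * (z * wa) ∈ cs.parabolic {a, b}ᶜ := by simpa using inv_mem hu.1
    have hyb := hy.mem_parabolic hJb (mul_mem (cs.parabolic_mono hJb hux) hwb_mem)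
    refine ⟨u * y, wa * wb, ((hmin hua hu.self).mul hJb hy.self hyb).of_mem ?_,
      (hmin hwa_mem hwa_min).mul hJb hwb_min hwb_mem, ?_⟩
    · simpa [mul_assoc] using hy.1
    · exact CoxeterSystem.bruhatLE_mul_mul
        (hwa_min.length_mul_inv_add_length hJa hfina hwa_mem hwa_max hua hu.self)
        (hwb_min.length_mul_inv_add_length hJb hfinb hwb_mem hwb_max hyb hy.self)
        ((hmin hwa_mem hwa_min).length_mul hwb_mem)
  exact ⟨main, fun s hs ↦ main _ (cs.simple_mem_parabolic hs)⟩
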